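/- Assume 1 < p < ∞, let f₀ be an extremal function for the p-modulus, and assume essinf_M f₀ > 0. Then for μ-almost every x ∈ M one has f₀(x) = J(x)^{1/(p−1)} / ∫_M J^{1/(p−1)} dν_{π(x)}, and moreover Mod_p(N)^p = ∫_N ( ∫_M J^{1/(p−1)} dν_y )^{1−p} dσ(y). -/

import Mathlib

open MeasureTheory ENNReal Filter

variable {M N : Type*}

/-- `f : M → [0,∞]` is `p`-admissible for a measurable set `S ⊆ N`:
`f` is measurable, `∫_M f^p dμ < ∞`, and `∫_M f dν_y ≥ 1` for `σ`-a.e. `y ∈ S`. -/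
def IsAdmissible [MeasurableSpace M] [MeasurableSpace N]
    (μ : Measure M) (σ : Measure N) (ν : N → Measure M) (p : ℝ)
    (S : Set N) (f : M → ℝ≥0∞) : Prop :=
  Measurable f ∧ (∫⁻ x, f x ^ p ∂μ) < ∞ ∧ ∀ᵐ y ∂σ, y ∈ S → 1 ≤ ∫⁻ x, f x ∂(ν y)

/-- The `p`-modulus of `S ⊆ N`: the infimum of `(∫_M f^p dμ)^{1/p}` over all
`p`-admissible `f` for `S` (`∞` if there is no admissible function). -/
noncomputable def Modulus [MeasurableSpace M] [MeasurableSpace N]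
    (μ : Measure M) (σ : Measure N) (ν : N → Measure M) (p : ℝ) (S : Set N) : ℝ≥0∞ :=
  ⨅ (f : M → ℝ≥0∞) (_ : IsAdmissible μ σ ν p S f), (∫⁻ x, f x ^ p ∂μ) ^ (1 / p)

/-- `f₀` is extremal for the `p`-modulus: admissible for all of `N`, realizing the modulus. -/
def IsExtremal [MeasurableSpace M] [MeasurableSpace N]
    (μ : Measure M) (σ : Measure N) (ν : N → Measure M) (p : ℝ)
    (f₀ : M → ℝ≥0∞) : Prop :=
  IsAdmissible μ σ ν p Set.univ f₀ ∧
    (∫⁻ x, f₀ x ^ p ∂μ) ^ (1 / p) = Modulus μ σ ν p Set.univ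

section Pointwise

theorem Real.mul_le_rpow_add_sub_one {p u : ℝ} (hp : 1 < p) (hu : 0 ≤ u) :
    p * u ≤ u ^ p + (p - 1) := by
  have h := one_add_mul_self_le_rpow_one_add (s := u - 1) (by linarith) hp.le
  rw [add_sub_cancel] at h
  linarith

theorem Real.eq_one_of_mul_eq_rpow_add_sub_one {p u : ℝ} (hp : 1 < p) (hu : 0 ≤ u)
    (h : p * u = u ^ p + (p - 1)) : u = 1 := by
  by_contra hne
  have h' := one_add_mul_self_lt_rpow_one_add (s := u - 1) (by linarith) (sub_ne_zero.2 hne) hp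
  rw [add_sub_cancel] at h'
  linarith

theorem ENNReal.mul_le_rpow_add_sub_one {p : ℝ} (hp : 1 < p) (u : ℝ≥0∞) :
    ENNReal.ofReal p * u ≤ u ^ p + ENNReal.ofReal (p - 1) := by
  have hp0 : 0 < p := by linarith
  rcases eq_or_ne u ∞ with rfl | hu
  · simp [ENNReal.top_rpow_of_pos hp0]
  · lift u to NNReal using hu
    rw [← ENNReal.ofReal_coe_nnreal, ← ENNReal.ofReal_mul hp0.le,
      ENNReal.ofReal_rpow_of_nonneg u.coe_nonneg hp0.le,
      ← ENNReal.ofReal_add (by positivity) (by linarith)]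
    exact ENNReal.ofReal_le_ofReal (Real.mul_le_rpow_add_sub_one hp u.coe_nonneg)

theorem ENNReal.eq_one_of_mul_eq_rpow_add_sub_one {p : ℝ} (hp : 1 < p) {u : ℝ≥0∞} (hu : u ≠ ∞)
    (h : ENNReal.ofReal p * u = u ^ p + ENNReal.ofReal (p - 1)) : u = 1 := by
  have hp0 : 0 < p := by linarith
  lift u to NNReal using hu
  rw [← ENNReal.ofReal_coe_nnreal, ← ENNReal.ofReal_mul hp0.le,
    ENNReal.ofReal_rpow_of_nonneg u.coe_nonneg hp0.le, ← ENNReal.ofReal_add (by positivity) (by linarith),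
    ENNReal.ofReal_eq_ofReal_iff (by positivity)
      (add_nonneg (by positivity) (by linarith))] at h
  have := Real.eq_one_of_mul_eq_rpow_add_sub_one hp u.coe_nonneg h
  rw [← ENNReal.ofReal_coe_nnreal, this, ENNReal.ofReal_one]

theorem ENNReal.div_rpow_mul_self {p : ℝ} (hp : 0 < p) (f : ℝ≥0∞) {w : ℝ≥0∞} (hw0 : w ≠ 0)
    (hw : w ≠ ∞) : (f / w) ^ p * w = f ^ p * w ^ (1 - p) := by
  rw [ENNReal.div_rpow_of_nonneg _ _ hp.le, div_eq_mul_inv, mul_assoc, ← ENNReal.rpow_neg]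
  congr 1
  nth_rewrite 2 [← ENNReal.rpow_one w]
  rw [← ENNReal.rpow_add _ _ hw0 hw]
  congr 1
  ring

/-- Weighted Young inequality, tangent form at `w`. -/
theorem ENNReal.mul_le_rpow_mul_add {p : ℝ} (hp : 1 < p) (f : ℝ≥0∞) {w : ℝ≥0∞} (hw0 : w ≠ 0)
    (hw : w ≠ ∞) :
    ENNReal.ofReal p * f ≤ f ^ p * w ^ (1 - p) + ENNReal.ofReal (p - 1) * w := by
  have h := mul_le_mul_left (ENNReal.mul_le_rpow_add_sub_one hp (f / w)) w
  rwa [mul_assoc, ENNReal.div_mul_cancel hw0 hw, add_mul,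
    ENNReal.div_rpow_mul_self (by linarith) f hw0 hw] at h

theorem ENNReal.eq_of_mul_eq_rpow_mul_add {p : ℝ} (hp : 1 < p) {f w : ℝ≥0∞} (hf : f ≠ ∞)
    (hw0 : w ≠ 0) (hw : w ≠ ∞)
    (h : ENNReal.ofReal p * f = f ^ p * w ^ (1 - p) + ENNReal.ofReal (p - 1) * w) : f = w := by
  rw [← ENNReal.div_rpow_mul_self (by linarith) f hw0 hw, ← add_mul] at h
  have h' : ENNReal.ofReal p * (f / w) = (f / w) ^ p + ENNReal.ofReal (p - 1) := by
    rw [← mul_div_assoc, h, ENNReal.mul_div_cancel_right hw0 hw]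
  have := ENNReal.eq_one_of_mul_eq_rpow_add_sub_one hp (ENNReal.div_ne_top hf hw0) h'
  rwa [ENNReal.div_eq_one_iff hw0 hw] at this

theorem ENNReal.div_rpow_one_sub {p : ℝ} (hp : 1 < p) {j I : ℝ≥0∞} (hj0 : j ≠ 0) (hj : j ≠ ∞)
    (hI0 : I ≠ 0) :
    (j ^ (1 / (p - 1)) / I) ^ (1 - p) = j⁻¹ * I ^ (p - 1) := by
  have hp' : p - 1 ≠ 0 := by linarith
  rw [div_eq_mul_inv, ENNReal.mul_rpow_of_ne_top
    (ENNReal.rpow_ne_top_of_ne_zero hj0 hj) (ENNReal.inv_ne_top.2 hI0), ← ENNReal.rpow_mul,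
    ENNReal.inv_rpow, ← ENNReal.rpow_neg, ← ENNReal.rpow_neg_one]
  congr 2
  · field_simp; ring
  · ring

theorem ENNReal.div_rpow_div {p : ℝ} (hp : 1 < p) {j : ℝ≥0∞} (hj0 : j ≠ 0) (hj : j ≠ ∞)
    (I : ℝ≥0∞) :
    (j ^ (1 / (p - 1)) / I) ^ p / j = j ^ (1 / (p - 1)) * I ^ (-p) := by
  have hp' : p - 1 ≠ 0 := by linarith
  rw [ENNReal.div_rpow_of_nonneg _ _ (by linarith), div_eq_mul_inv, div_eq_mul_inv,
    mul_right_comm, ← ENNReal.rpow_neg, ← ENNReal.rpow_mul, ← ENNReal.rpow_neg_one j,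
    ← ENNReal.rpow_add _ _ hj0 hj]
  congr 2
  field_simp
  ring

end Pointwise

section Fiber

variable {α : Type*} [MeasurableSpace α] {m : Measure α} {p : ℝ} {J f : α → ℝ≥0∞}

/-- On a single leaf, a function of mass at least one whose weighted energy does not exceed the
optimal value is the optimizer, and its energy is the optimal value. -/
theorem lintegral_rpow_div_eq_and_ae_eq (hp : 1 < p) (hJ : Measurable J) (hJ0 : ∀ x, 0 < J x)
    (hJtop : ∀ x, J x < ∞) (hf : Measurable f) (hI0 : ∫⁻ x, J x ^ (1 / (p - 1)) ∂m ≠ 0)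
    (hI : ∫⁻ x, J x ^ (1 / (p - 1)) ∂m ≠ ∞) (h1 : 1 ≤ ∫⁻ x, f x ∂m)
    (hE : ∫⁻ x, f x ^ p / J x ∂m ≤ (∫⁻ x, J x ^ (1 / (p - 1)) ∂m) ^ (1 - p)) :
    ∫⁻ x, f x ^ p / J x ∂m = (∫⁻ x, J x ^ (1 / (p - 1)) ∂m) ^ (1 - p) ∧
      ∀ᵐ x ∂m, f x = J x ^ (1 / (p - 1)) / ∫⁻ z, J z ^ (1 / (p - 1)) ∂m := by
  set I := ∫⁻ x, J x ^ (1 / (p - 1)) ∂m with hIdef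
  set E := ∫⁻ x, f x ^ p / J x ∂m with hEdef
  have hp0 : 0 < p := by linarith
  set w : α → ℝ≥0∞ := fun x => J x ^ (1 / (p - 1)) / I with hw
  have hwm : Measurable w := (hJ.pow_const _).div_const _
  have hw0 : ∀ x, w x ≠ 0 := fun x =>
    ENNReal.div_ne_zero.2 ⟨(ENNReal.rpow_pos (hJ0 x) (hJtop x).ne).ne', hI⟩
  have hwtop : ∀ x, w x ≠ ∞ := fun x =>
    ENNReal.div_ne_top (ENNReal.rpow_ne_top_of_ne_zero (hJ0 x).ne' (hJtop x).ne) hI0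
  have hw1 : ∫⁻ x, w x ∂m = 1 := by
    simp only [hw, div_eq_mul_inv]
    rw [lintegral_mul_const _ (hJ.pow_const _)]
    exact ENNReal.mul_inv_cancel hI0 hI
  set R : α → ℝ≥0∞ := fun x => f x ^ p * w x ^ (1 - p) + ENNReal.ofReal (p - 1) * w x with hR
  have hRm : Measurable R :=
    ((hf.pow_const _).mul (hwm.pow_const _)).add (hwm.const_mul _)
  have hRint : ∫⁻ x, R x ∂m = E * I ^ (p - 1) + ENNReal.ofReal (p - 1) := by
    simp only [hR]
    rw [lintegral_add_right _ (hwm.const_mul _), lintegral_const_mul _ hwm, hw1, mul_one, hEdef,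
      ← lintegral_mul_const (f := fun x => f x ^ p / J x) _ ((hf.pow_const p).div hJ)]
    congr 1
    refine lintegral_congr fun x => ?_
    simp only [hw]
    rw [ENNReal.div_rpow_one_sub hp (hJ0 x).ne' (hJtop x).ne hI0, div_eq_mul_inv, mul_assoc]
  have hII : I ^ (1 - p) * I ^ (p - 1) = 1 := by
    rw [← ENNReal.rpow_add _ _ hI0 hI]; simp
  have hpp : (1 : ℝ≥0∞) + ENNReal.ofReal (p - 1) = ENNReal.ofReal p := by
    rw [← ENNReal.ofReal_one, ← ENNReal.ofReal_add zero_le_one (by linarith), add_sub_cancel]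
  have hLR : ∀ x, ENNReal.ofReal p * f x ≤ R x := fun x =>
    ENNReal.mul_le_rpow_mul_add hp (f x) (hw0 x) (hwtop x)
  have hL : ENNReal.ofReal p ≤ ∫⁻ x, ENNReal.ofReal p * f x ∂m := by
    rw [lintegral_const_mul _ hf]
    exact le_mul_of_one_le_right' h1
  have hLRint : ∫⁻ x, ENNReal.ofReal p * f x ∂m ≤ ∫⁻ x, R x ∂m := lintegral_mono hLR
  have hRle : ∫⁻ x, R x ∂m ≤ ENNReal.ofReal p := by
    rw [hRint, ← hpp]
    gcongr
    exact (mul_le_mul_left hE _).trans_eq hII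
  have hLtop : ∫⁻ x, ENNReal.ofReal p * f x ∂m ≠ ∞ :=
    ((hLRint.trans hRle).trans_lt ENNReal.ofReal_lt_top).ne
  constructor
  · refine hE.antisymm ?_
    have h2 : 1 ≤ E * I ^ (p - 1) := by
      have := hL.trans hLRint
      rw [hRint, ← hpp] at this
      exact (ENNReal.add_le_add_iff_right ENNReal.ofReal_ne_top).1 this
    calc I ^ (1 - p) = I ^ (1 - p) * 1 := (mul_one _).symm
      _ ≤ I ^ (1 - p) * (E * I ^ (p - 1)) := by gcongr
      _ = E := by rw [mul_left_comm, hII, mul_one]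
  · have hae := ae_eq_of_ae_le_of_lintegral_le (Eventually.of_forall hLR) hLtop hRm.aemeasurable
      (hRle.trans hL)
    filter_upwards [hae, ae_lt_top (hf.const_mul _) hLtop] with x hx hxt
    have hfx : f x ≠ ∞ := by
      rintro h
      simp [h, hp0] at hxt
    exact ENNReal.eq_of_mul_eq_rpow_mul_add hp hfx (hw0 x) (hwtop x) hx

end Fiber

section Exchange

variable {M N : Type*} [MeasurableSpace M] [MeasurableSpace N]
  {μ : Measure M} {σ : Measure N} {ν : N → Measure M} {p : ℝ} {π : M → N} {J f₀ : M → ℝ≥0∞}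

theorem IsExtremal.lintegral_rpow_eq (hp : 0 < p) (hf₀ : IsExtremal μ σ ν p f₀) :
    ∫⁻ x, f₀ x ^ p ∂μ = Modulus μ σ ν p Set.univ ^ p := by
  rw [← hf₀.2, ← ENNReal.rpow_mul, one_div_mul_cancel hp.ne', ENNReal.rpow_one]

theorem IsExtremal.lintegral_rpow_le (hp : 0 < p) (hf₀ : IsExtremal μ σ ν p f₀)
    {f : M → ℝ≥0∞} (hf : IsAdmissible μ σ ν p Set.univ f) :
    ∫⁻ x, f₀ x ^ p ∂μ ≤ ∫⁻ x, f x ^ p ∂μ := by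
  have h : Modulus μ σ ν p Set.univ ≤ (∫⁻ x, f x ^ p ∂μ) ^ (1 / p) := iInf₂_le f hf
  rw [hf₀.lintegral_rpow_eq hp]
  calc _ ≤ ((∫⁻ x, f x ^ p ∂μ) ^ (1 / p)) ^ p := ENNReal.rpow_le_rpow h hp.le
    _ = _ := by rw [← ENNReal.rpow_mul, one_div_mul_cancel hp.ne', ENNReal.rpow_one]

/-- An extremal function cannot be improved on a set of leaves of positive measure. -/
theorem IsExtremal.measure_eq_zero_of_energy_lt (hp : 0 < p) (hπ : Measurable π)
    (hker : Measurable ν) (hleaf : ∀ᵐ y ∂σ, ∀ᵐ x ∂(ν y), π x = y) (hJ : Measurable J)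
    (hFubini : ∀ f : M → ℝ≥0∞, Measurable f →
      ∫⁻ x, f x ∂μ = ∫⁻ y, (∫⁻ x, f x / J x ∂(ν y)) ∂σ)
    (hf₀ : IsExtremal μ σ ν p f₀) {g : M → ℝ≥0∞} (hg : Measurable g) {B : Set N}
    (hB : MeasurableSet B) (hg1 : ∀ᵐ y ∂σ, y ∈ B → 1 ≤ ∫⁻ x, g x ∂(ν y))
    (hlt : ∀ᵐ y ∂σ, y ∈ B → ∫⁻ x, g x ^ p / J x ∂(ν y) < ∫⁻ x, f₀ x ^ p / J x ∂(ν y)) :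
    σ B = 0 := by
  classical
  by_contra hσ
  have hf₀m := hf₀.1.1
  have hbase := hf₀.1.2.1
  set f : M → ℝ≥0∞ := (π ⁻¹' B).piecewise g f₀ with hf
  have hfm : Measurable f := hg.piecewise (hπ hB) hf₀m
  have hfB : ∀ᵐ y ∂σ, y ∈ B → f =ᵐ[ν y] g := by
    filter_upwards [hleaf] with y hy hyB
    filter_upwards [hy] with x hx
    exact Set.piecewise_eq_of_mem _ _ _ (by simpa [hx] using hyB)
  have hfBc : ∀ᵐ y ∂σ, y ∉ B → f =ᵐ[ν y] f₀ := by
    filter_upwards [hleaf] with y hy hyB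
    filter_upwards [hy] with x hx
    exact Set.piecewise_eq_of_notMem _ _ _ (by simpa [hx] using hyB)
  have hE : ∀ {k h : M → ℝ≥0∞} {y : N}, k =ᵐ[ν y] h →
      ∫⁻ x, k x ^ p / J x ∂(ν y) = ∫⁻ x, h x ^ p / J x ∂(ν y) := fun hkh =>
    lintegral_congr_ae (by filter_upwards [hkh] with x hx; rw [hx])
  have hltB : ∀ᵐ y ∂σ, y ∈ B →
      ∫⁻ x, f x ^ p / J x ∂(ν y) < ∫⁻ x, f₀ x ^ p / J x ∂(ν y) := by
    filter_upwards [hfB, hlt] with y hy hy' hyB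
    rw [hE (hy hyB)]
    exact hy' hyB
  have hle : ∀ᵐ y ∂σ, ∫⁻ x, f x ^ p / J x ∂(ν y) ≤ ∫⁻ x, f₀ x ^ p / J x ∂(ν y) := by
    filter_upwards [hltB, hfBc] with y hy hy'
    by_cases hyB : y ∈ B
    · exact (hy hyB).le
    · exact (hE (hy' hyB)).le
  have hfle : ∫⁻ x, f x ^ p ∂μ ≤ ∫⁻ x, f₀ x ^ p ∂μ := by
    rw [hFubini _ (hfm.pow_const p), hFubini _ (hf₀m.pow_const p)]
    exact lintegral_mono_ae hle
  have hfin : ∫⁻ x, f x ^ p ∂μ < ∞ := hfle.trans_lt hbase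
  have hadm : IsAdmissible μ σ ν p Set.univ f := by
    refine ⟨hfm, hfin, ?_⟩
    filter_upwards [hfB, hfBc, hg1, hf₀.1.2.2] with y h1 h2 h3 h4 _
    by_cases hyB : y ∈ B
    · rw [lintegral_congr_ae (h1 hyB)]
      exact h3 hyB
    · rw [lintegral_congr_ae (h2 hyB)]
      exact h4 trivial
  refine (hf₀.lintegral_rpow_le hp hadm).not_gt ?_
  rw [hFubini _ (hfm.pow_const p), hFubini _ (hf₀m.pow_const p)]
  refine lintegral_strict_mono_of_ae_le_of_ae_lt_on ?_ ?_ hle hσ hltB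
  · exact ((Measure.measurable_lintegral ((hf₀m.pow_const p).div hJ)).comp hker).aemeasurable
  · rw [← hFubini _ (hfm.pow_const p)]
    exact hfin.ne

/-- On almost every leaf the energy of an extremal function is bounded by the optimal energy of
competitors supported in `A`. -/
theorem IsExtremal.ae_energy_le (hp : 1 < p) (hπ : Measurable π)
    (hker : Measurable ν) (hleaf : ∀ᵐ y ∂σ, ∀ᵐ x ∂(ν y), π x = y) (hJ : Measurable J)
    (hJ0 : ∀ x, 0 < J x) (hJtop : ∀ x, J x < ∞)
    (hFubini : ∀ f : M → ℝ≥0∞, Measurable f →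
      ∫⁻ x, f x ∂μ = ∫⁻ y, (∫⁻ x, f x / J x ∂(ν y)) ∂σ)
    (hf₀ : IsExtremal μ σ ν p f₀) {A : Set M} (hA : MeasurableSet A)
    (hfin : ∀ᵐ y ∂σ, ∫⁻ x in A, J x ^ (1 / (p - 1)) ∂(ν y) ≠ ∞) :
    ∀ᵐ y ∂σ, ∫⁻ x, f₀ x ^ p / J x ∂(ν y) ≤
      (∫⁻ x in A, J x ^ (1 / (p - 1)) ∂(ν y)) ^ (1 - p) := by
  have hp0 : 0 < p := by linarith
  set I : N → ℝ≥0∞ := fun y => ∫⁻ x in A, J x ^ (1 / (p - 1)) ∂(ν y) with hIdef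
  have hIm : Measurable I := by
    have : I = fun y => ∫⁻ x, A.indicator (fun x => J x ^ (1 / (p - 1))) x ∂(ν y) := by
      ext y
      rw [lintegral_indicator hA]
    rw [this]
    exact (Measure.measurable_lintegral ((hJ.pow_const _).indicator hA)).comp hker
  have hEm : Measurable fun y => ∫⁻ x, f₀ x ^ p / J x ∂(ν y) :=
    (Measure.measurable_lintegral ((hf₀.1.1.pow_const p).div hJ)).comp hker
  set g : M → ℝ≥0∞ := A.indicator fun x => J x ^ (1 / (p - 1)) / I (π x) with hgdef
  have hgm : Measurable g := ((hJ.pow_const _).div (hIm.comp hπ)).indicator hA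
  have hg : ∀ᵐ y ∂σ, g =ᵐ[ν y] A.indicator fun x => J x ^ (1 / (p - 1)) / I y := by
    filter_upwards [hleaf] with y hy
    filter_upwards [hy] with x hx
    simp only [hgdef, Set.indicator, hx]
  set B : Set N := {y | I y ^ (1 - p) < ∫⁻ x, f₀ x ^ p / J x ∂(ν y)} with hBdef
  have hB : MeasurableSet B := measurableSet_lt (hIm.pow_const _) hEm
  have hI0 : ∀ y ∈ B, I y ≠ 0 := by
    intro y hy h
    simp only [hBdef, Set.mem_ofPred_eq, h, ENNReal.zero_rpow_of_neg (by linarith : 1 - p < 0)]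
      at hy
    exact not_top_lt hy
  suffices σ B = 0 by
    rw [ae_iff]
    simpa only [not_le] using this
  refine hf₀.measure_eq_zero_of_energy_lt hp0 hπ hker hleaf hJ hFubini hgm hB ?_ ?_
  · filter_upwards [hg, hfin] with y hy hyI hyB
    rw [lintegral_congr_ae hy, lintegral_indicator hA]
    simp_rw [div_eq_mul_inv _ (I y)]
    rw [lintegral_mul_const _ (hJ.pow_const _)]
    exact (ENNReal.mul_inv_cancel (hI0 y hyB) hyI).ge
  · filter_upwards [hg, hfin] with y hy hyI hyB
    refine lt_of_eq_of_lt ?_ hyB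
    have h1 : ∫⁻ x, g x ^ p / J x ∂(ν y) =
        ∫⁻ x, A.indicator (fun x => J x ^ (1 / (p - 1)) * I y ^ (-p)) x ∂(ν y) := by
      refine lintegral_congr_ae ?_
      filter_upwards [hy] with x hx
      rw [hx]
      by_cases hxA : x ∈ A
      · simp only [Set.indicator_of_mem hxA]
        exact ENNReal.div_rpow_div hp (hJ0 x).ne' (hJtop x).ne _
      · simp [Set.indicator_of_notMem hxA, hp0]
    rw [h1, lintegral_indicator hA, lintegral_mul_const _ (hJ.pow_const _)]
    change I y * I y ^ (-p) = _
    nth_rewrite 1 [← ENNReal.rpow_one (I y)]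
    rw [← ENNReal.rpow_add _ _ (hI0 y hyB) hyI, sub_eq_add_neg]

theorem IsExtremal.measure_univ_lt_top (hp : 0 < p) (hf₀ : IsExtremal μ σ ν p f₀)
    (hinf : 0 < essInf f₀ μ) : μ Set.univ < ∞ := by
  obtain ⟨c, hc0, hc⟩ := exists_between hinf
  have hae : ∀ᵐ x ∂μ, c < f₀ x := ae_lt_of_lt_essInf hc
  have h : c ^ p * μ Set.univ < ∞ := by
    rw [← lintegral_const]
    refine lt_of_le_of_lt (lintegral_mono_ae ?_) hf₀.1.2.1
    filter_upwards [hae] with x hx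
    exact ENNReal.rpow_le_rpow hx.le hp.le
  rw [ENNReal.mul_lt_top_iff] at h
  rcases h with h | h | h
  · exact h.2
  · exact absurd h (ENNReal.rpow_pos hc0 hc.ne_top).ne'
  · simp [h]

end Exchange

theorem statement_17
    {M N : Type*} [MeasurableSpace M] [MeasurableSpace N]
    (μ : Measure M) (σ : Measure N) [SigmaFinite μ] [SigmaFinite σ]
    (ν : N → Measure M) (hνsf : ∀ y, SigmaFinite (ν y))
    (hker : ∀ A : Set M, MeasurableSet A → Measurable fun y => ν y A)
    (p : ℝ) (hp : 1 < p)
    (π : M → N) (hπ : Measurable π)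
    (hleaf : ∀ᵐ y ∂σ, ν y (Set.univ \ π ⁻¹' {y}) = 0)
    (J : M → ℝ≥0∞) (hJ : Measurable J) (hJ0 : ∀ x, 0 < J x) (hJtop : ∀ x, J x < ∞)
    (hFubini : ∀ f : M → ℝ≥0∞, Measurable f →
      ∫⁻ x, f x ∂μ = ∫⁻ y, (∫⁻ x, f x / J x ∂(ν y)) ∂σ)
    (f₀ : M → ℝ≥0∞) (hf₀ : IsExtremal μ σ ν p f₀) (hinf : 0 < essInf f₀ μ) :
    (∀ᵐ x ∂μ, f₀ x = J x ^ (1 / (p - 1)) / ∫⁻ z, J z ^ (1 / (p - 1)) ∂(ν (π x))) ∧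
      Modulus μ σ ν p Set.univ ^ p =
        ∫⁻ y, (∫⁻ x, J x ^ (1 / (p - 1)) ∂(ν y)) ^ (1 - p) ∂σ := by
  have hp0 : 0 < p := by linarith
  have hq0 : 0 < 1 / (p - 1) := one_div_pos.2 (by linarith)
  have hν : Measurable ν := Measure.measurable_of_measurable_coe _ hker
  have hleaf' : ∀ᵐ y ∂σ, ∀ᵐ x ∂(ν y), π x = y := by
    filter_upwards [hleaf] with y hy
    rw [ae_iff]
    refine measure_mono_null (fun x hx => ?_) hy
    exact ⟨trivial, hx⟩
  have hf₀m := hf₀.1.1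
  set I : N → ℝ≥0∞ := fun y => ∫⁻ x, J x ^ (1 / (p - 1)) ∂(ν y) with hIdef
  have hIm : Measurable I := (Measure.measurable_lintegral (hJ.pow_const _)).comp hν
  have hmass : ∀ᵐ y ∂σ, 1 ≤ ∫⁻ x, f₀ x ∂(ν y) := by
    filter_upwards [hf₀.1.2.2] with y hy using hy trivial
  have hI0 : ∀ᵐ y ∂σ, I y ≠ 0 := by
    filter_upwards [hmass] with y hy h
    have : ∀ᵐ x ∂(ν y), False := by
      filter_upwards [(lintegral_eq_zero_iff (hJ.pow_const _)).1 h] with x hx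
      exact (ENNReal.rpow_pos (hJ0 x) (hJtop x).ne).ne' hx
    rw [eventually_false_iff_eq_bot, ae_eq_bot] at this
    simp [this] at hy
  have hJinv : ∀ᵐ y ∂σ, ∫⁻ x, 1 / J x ∂(ν y) < ∞ := by
    refine ae_lt_top ((Measure.measurable_lintegral (hJ.const_div 1)).comp hν) ?_
    rw [← hFubini (fun _ => 1) measurable_const, lintegral_one]
    exact (hf₀.measure_univ_lt_top hp0 hinf).ne
  have hA : ∀ n : ℕ, MeasurableSet {x | J x ≤ n} := fun n => measurableSet_le hJ measurable_const
  have hEn : ∀ᵐ y ∂σ, ∀ n : ℕ, ∫⁻ x, f₀ x ^ p / J x ∂(ν y) ≤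
      (∫⁻ x in {x | J x ≤ n}, J x ^ (1 / (p - 1)) ∂(ν y)) ^ (1 - p) := by
    refine ae_all_iff.2 fun n => hf₀.ae_energy_le hp hπ hν hleaf' hJ hJ0 hJtop hFubini (hA n) ?_
    filter_upwards [hJinv] with y hy
    refine ne_top_of_le_ne_top
      (ENNReal.mul_ne_top (ENNReal.mul_ne_top
        (ENNReal.rpow_ne_top_of_nonneg hq0.le (ENNReal.natCast_ne_top n))
        (ENNReal.natCast_ne_top n)) hy.ne) ?_
    rw [← lintegral_const_mul _ (hJ.const_div 1)]
    refine (setLIntegral_mono ((hJ.const_div 1).const_mul _) fun x hx => ?_).trans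
      (setLIntegral_le_lintegral _ _)
    have hx' : J x ≤ n := hx
    calc J x ^ (1 / (p - 1)) = J x ^ (1 / (p - 1)) * J x * (1 / J x) := by
          rw [mul_assoc, one_div (J x), ENNReal.mul_inv_cancel (hJ0 x).ne' (hJtop x).ne, mul_one]
      _ ≤ _ := by gcongr
  have hE : ∀ᵐ y ∂σ, ∫⁻ x, f₀ x ^ p / J x ∂(ν y) ≤ I y ^ (1 - p) := by
    filter_upwards [hEn] with y hy
    have hlim : Tendsto (fun n : ℕ => ∫⁻ x in {x | J x ≤ n}, J x ^ (1 / (p - 1)) ∂(ν y)) atTop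
        (nhds (I y)) := by
      simp only [fun n : ℕ => (lintegral_indicator (μ := ν y) (hA n)
        (fun x => J x ^ (1 / (p - 1)))).symm]
      refine lintegral_tendsto_of_tendsto_of_monotone
        (fun n => ((hJ.pow_const _).indicator (hA n)).aemeasurable) ?_ ?_
      · refine Eventually.of_forall fun x a b hab => ?_
        refine Set.indicator_le_indicator_of_subset (fun z hz => ?_) (fun _ => zero_le) x
        exact le_trans (show J z ≤ a from hz) (by exact_mod_cast hab)
      · refine Eventually.of_forall fun x => tendsto_const_nhds.congr' ?_
        obtain ⟨k, hk⟩ := ENNReal.exists_nat_gt (hJtop x).ne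
        filter_upwards [eventually_ge_atTop k] with n hn
        rw [Set.indicator_of_mem]
        exact hk.le.trans (by exact_mod_cast hn)
    exact ge_of_tendsto' ((ENNReal.continuous_rpow_const.tendsto _).comp hlim) hy
  have hItop : ∀ᵐ y ∂σ, I y ≠ ∞ := by
    filter_upwards [hE, hmass] with y hy hy1 h
    rw [h, ENNReal.top_rpow_of_neg (by linarith : 1 - p < 0), nonpos_iff_eq_zero,
      lintegral_eq_zero_iff (f := fun x => f₀ x ^ p / J x) ((hf₀m.pow_const p).div hJ)] at hy
    have : ∫⁻ x, f₀ x ∂(ν y) = 0 := by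
      rw [lintegral_eq_zero_iff hf₀m]
      filter_upwards [hy] with x hx
      have hx' : f₀ x ^ p / J x = 0 := hx
      rw [ENNReal.div_eq_zero_iff, ENNReal.rpow_eq_zero_iff_of_pos hp0] at hx'
      exact hx'.resolve_right (hJtop x).ne
    simp [this] at hy1
  have hfiber : ∀ᵐ y ∂σ, ∫⁻ x, f₀ x ^ p / J x ∂(ν y) = I y ^ (1 - p) ∧
      ∀ᵐ x ∂(ν y), f₀ x = J x ^ (1 / (p - 1)) / I y := by
    filter_upwards [hE, hmass, hI0, hItop] with y h1 h2 h3 h4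
    exact lintegral_rpow_div_eq_and_ae_eq hp hJ hJ0 hJtop hf₀m h3 h4 h2 h1
  constructor
  · set S : Set M := {x | f₀ x = J x ^ (1 / (p - 1)) / I (π x)} with hS
    have hSm : MeasurableSet S :=
      measurableSet_eq_fun hf₀m ((hJ.pow_const _).div (hIm.comp hπ))
    change μ Sᶜ = 0
    rw [← lintegral_indicator_one hSm.compl, hFubini _ (measurable_one.indicator hSm.compl)]
    refine (lintegral_congr_ae ?_).trans lintegral_zero
    filter_upwards [hfiber, hleaf'] with y hy hy'
    refine (lintegral_congr_ae ?_).trans lintegral_zero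
    filter_upwards [hy.2, hy'] with x hx hx'
    have : x ∈ S := by simpa [hS, hx'] using hx
    simp [this]
  · rw [← hf₀.lintegral_rpow_eq hp0, hFubini _ (hf₀m.pow_const p)]
    exact lintegral_congr_ae (hfiber.mono fun y hy => hy.1)
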